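/- The set K_a := {a ∈ ℝ^𝒳 : there exists r ∈ K_r with 0 ≤ a_x ≤ A_x(r) for all x} is a convex corner: it is convex, compact, contained in [0,∞)^𝒳, downward closed (if a ∈ K_a and 0 ≤ a' ≤ a coordinatewise then a' ∈ K_a), and contains a point all of whose coordinates are strictly positive. -/

import Mathlib

noncomputable section

open Finset

variable {X Y J : Type*}

/-- `f(u,v) = u·log u − u·log v` with the conventions `f(0,v) = 0` and `f(u,0) = +∞` for `u > 0`,
taking values in the extended reals. -/
def fdiv (u v : ℝ) : EReal :=
  if u = 0 then 0
  else if v = 0 then (⊤ : EReal)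
  else ((u * Real.log u - u * Real.log v : ℝ) : EReal)

/-- Marginal `p_x := ∑_y p_{x,y}`. -/
def margX [Fintype Y] (p : X → Y → ℝ) (x : X) : ℝ := ∑ y, p x y

/-- Marginal `p^y := ∑_x p_{x,y}`. -/
def margY [Fintype X] (p : X → Y → ℝ) (y : Y) : ℝ := ∑ x, p x y

/-- The polytope `K_q`: `q_{j|x} ≥ 0`, `∑_{j∋x} q_{j|x} = 1` for every `x`,
and `q_{j|x} = 0` whenever `x ∉ j`. -/
def Kq [Fintype J] [DecidableEq X] (S : J → Finset X) : Set (J → X → ℝ) :=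
  {q | (∀ j x, 0 ≤ q j x) ∧ (∀ x, (∑ j, if x ∈ S j then q j x else 0) = 1) ∧
    (∀ j x, x ∉ S j → q j x = 0)}

/-- The polytope `K_r`: `r_{j|y} ≥ 0` and `∑_j r_{j|y} = 1` for every `y`. -/
def Kr (J Y : Type*) [Fintype J] : Set (J → Y → ℝ) :=
  {r | (∀ j y, 0 ≤ r j y) ∧ ∀ y, (∑ j, r j y) = 1}

/-- `φ(q,r) := ∑_{x,y,j} p_{x,y} · f(q_{j|x}, r_{j|y})`, extended-real valued. -/
def phi [Fintype X] [Fintype Y] [Fintype J] (p : X → Y → ℝ)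
    (q : J → X → ℝ) (r : J → Y → ℝ) : EReal :=
  ∑ x, ∑ y, ∑ j, (p x y : EReal) * fdiv (q j x) (r j y)

/-- `δ(q,q') := ∑_x p_x ∑_{j∋x} f(q_{j|x}, q'_{j|x})`, extended-real valued. -/
def delta [Fintype X] [Fintype Y] [Fintype J] [DecidableEq X] (p : X → Y → ℝ)
    (S : J → Finset X) (q q' : J → X → ℝ) : EReal :=
  ∑ x, (margX p x : EReal) * ∑ j, (if x ∈ S j then fdiv (q j x) (q' j x) else 0)

/-- `R_{j|y}(q) := ∑_{x∈j} p_{x|y} q_{j|x}`. -/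
def Rmap [Fintype X] [Fintype Y] [DecidableEq X] (p : X → Y → ℝ) (S : J → Finset X)
    (q : J → X → ℝ) : J → Y → ℝ :=
  fun j y => ∑ x, if x ∈ S j then (p x y / margY p y) * q j x else 0

/-- `A_x(r) := ∑_{j∋x} ∏_y (r_{j|y})^{p^{y|x}}` (real powers, with `0^0 = 1`). -/
def Afun [Fintype Y] [Fintype J] [DecidableEq X] (p : X → Y → ℝ) (S : J → Finset X)
    (r : J → Y → ℝ) (x : X) : ℝ :=
  ∑ j, if x ∈ S j then (∏ y, r j y ^ (p x y / margX p x)) else 0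

/-- `Q_{j|x}(r) := (∏_y (r_{j|y})^{p^{y|x}}) / A_x(r)` if `x ∈ j`, and `0` otherwise. -/
def Qmap [Fintype Y] [Fintype J] [DecidableEq X] (p : X → Y → ℝ) (S : J → Finset X)
    (r : J → Y → ℝ) : J → X → ℝ :=
  fun j x => if x ∈ S j then (∏ y, r j y ^ (p x y / margX p x)) / Afun p S r x else 0

open Classical in
/-- `φ_r(r) := −∑_x p_x log A_x(r)`, equal to `+∞` if `A_x(r) = 0` for some `x`. -/
def phiR [Fintype X] [Fintype Y] [Fintype J] [DecidableEq X] (p : X → Y → ℝ)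
    (S : J → Finset X) (r : J → Y → ℝ) : EReal :=
  if ∃ x, Afun p S r x = 0 then ⊤
  else (((- ∑ x, margX p x * Real.log (Afun p S r x)) : ℝ) : EReal)

/-- The explicit real-valued formula for `φ_q`:
`∑_x p_x ∑_{j∋x} q_{j|x} log q_{j|x} − ∑_y p^y ∑_j R_{j|y}(q) log R_{j|y}(q)`
(with the convention `0·log 0 = 0`, automatic since `Real.log 0 = 0`). -/
def phiQexp [Fintype X] [Fintype Y] [Fintype J] [DecidableEq X] (p : X → Y → ℝ)
    (S : J → Finset X) (q : J → X → ℝ) : ℝ :=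
  (∑ x, margX p x * ∑ j, if x ∈ S j then q j x * Real.log (q j x) else 0)
    - ∑ y, margY p y * ∑ j, Rmap p S q j y * Real.log (Rmap p S q j y)

/-- The convex corner `K_a := {a : 0 ≤ a_x ≤ A_x(r) (∀x) for some r ∈ K_r}`. -/
def Ka [Fintype X] [Fintype Y] [Fintype J] [DecidableEq X] (p : X → Y → ℝ)
    (S : J → Finset X) : Set (X → ℝ) :=
  {a | ∃ r ∈ Kr J Y, ∀ x, 0 ≤ a x ∧ a x ≤ Afun p S r x}

open Classical in
/-- `φ_a(a) := −∑_x p_x log a_x`, equal to `+∞` if `a_x = 0` for some `x`. -/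
def phiA [Fintype X] [Fintype Y] (p : X → Y → ℝ) (a : X → ℝ) : EReal :=
  if ∃ x, a x = 0 then ⊤
  else (((- ∑ x, margX p x * Real.log (a x)) : ℝ) : EReal)

/-- Weighted geometric means are superadditive on nonnegative vectors. -/
lemma prod_rpow_add_prod_rpow_le {ι : Type*} [Fintype ι] {w u v : ι → ℝ}
    (hw : ∀ i, 0 ≤ w i) (hw1 : ∑ i, w i = 1) (hu : ∀ i, 0 ≤ u i) (hv : ∀ i, 0 ≤ v i) :
    ∏ i, u i ^ w i + ∏ i, v i ^ w i ≤ ∏ i, (u i + v i) ^ w i := by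
  have huv : ∀ i, 0 ≤ u i + v i := fun i => add_nonneg (hu i) (hv i)
  have hnonneg : 0 ≤ ∏ i, (u i + v i) ^ w i :=
    prod_nonneg fun i _ => Real.rpow_nonneg (huv i) _
  rcases hnonneg.eq_or_lt with h0 | hpos
  · obtain ⟨i, -, hi⟩ := prod_eq_zero_iff.1 h0.symm
    obtain ⟨hi0, hwi⟩ := (Real.rpow_eq_zero_iff_of_nonneg (huv i)).1 hi
    have hui : u i = 0 := by linarith [hu i, hv i]
    have hvi : v i = 0 := by linarith [hu i, hv i]
    rw [← h0, prod_eq_zero (mem_univ i) (by rw [hui, Real.zero_rpow hwi]),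
      prod_eq_zero (mem_univ i) (by rw [hvi, Real.zero_rpow hwi]), add_zero]
  · have key : ∀ z : ι → ℝ, (∀ i, 0 ≤ z i) →
        (∏ i, z i ^ w i) / ∏ i, (u i + v i) ^ w i ≤ ∑ i, w i * (z i / (u i + v i)) := by
      intro z hz
      rw [← prod_div_distrib]
      simp_rw [← Real.div_rpow (hz _) (huv _)]
      exact Real.geom_mean_le_arith_mean_weighted _ _ _ (fun i _ => hw i) hw1
        fun i _ => div_nonneg (hz i) (huv i)
    rw [← div_le_one hpos, add_div]
    refine (add_le_add (key u hu) (key v hv)).trans ?_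
    rw [← sum_add_distrib, ← hw1]
    refine sum_le_sum fun i _ => ?_
    rw [← mul_add, ← add_div]
    exact mul_le_of_le_one_right (hw i) (div_self_le_one _)

/-- Weighted geometric means are positively homogeneous of degree one. -/
lemma prod_mul_rpow_of_sum_eq_one {ι : Type*} [Fintype ι] {w u : ι → ℝ} {c : ℝ}
    (hw : ∀ i, 0 ≤ w i) (hw1 : ∑ i, w i = 1) (hc : 0 ≤ c) (hu : ∀ i, 0 ≤ u i) :
    ∏ i, (c * u i) ^ w i = c * ∏ i, u i ^ w i := by
  simp_rw [Real.mul_rpow hc (hu _)]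
  rw [prod_mul_distrib, ← Real.rpow_sum_of_nonneg hc fun i _ => hw i, hw1, Real.rpow_one]

lemma convex_Kr (J Y : Type*) [Fintype J] : Convex ℝ (Kr J Y) := by
  rintro r ⟨hr, hr1⟩ s ⟨hs, hs1⟩ α β hα hβ hαβ
  refine ⟨fun j y => add_nonneg (mul_nonneg hα (hr j y)) (mul_nonneg hβ (hs j y)), fun y => ?_⟩
  simp only [Pi.add_apply, Pi.smul_apply, smul_eq_mul, sum_add_distrib, ← mul_sum, hr1, hs1,
    mul_one, hαβ]

lemma isCompact_Kr (J Y : Type*) [Fintype J] : IsCompact (Kr J Y) := by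
  have hclosed : IsClosed (Kr J Y) := by
    simp only [Kr, Set.ofPred_and, Set.ofPred_forall]
    refine IsClosed.inter (isClosed_iInter fun j => isClosed_iInter fun y => ?_)
      (isClosed_iInter fun y => ?_)
    · exact isClosed_le (by fun_prop) (by fun_prop)
    · exact isClosed_eq (by fun_prop) (by fun_prop)
  refine (isCompact_univ_pi fun _ : J => isCompact_univ_pi fun _ : Y =>
    isCompact_Icc (a := (0 : ℝ)) (b := 1)).of_isClosed_subset hclosed ?_
  intro r hr j _ y _
  exact ⟨hr.1 j y, (single_le_sum (fun i _ => hr.1 i y) (mem_univ j)).trans_eq (hr.2 y)⟩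

section Afun

variable [Fintype Y] [Fintype J] [DecidableEq X] {p : X → Y → ℝ} {S : J → Finset X}

lemma Afun_nonneg {r : J → Y → ℝ} (hr : ∀ j y, 0 ≤ r j y) (x : X) : 0 ≤ Afun p S r x := by
  refine sum_nonneg fun j _ => ?_
  split_ifs
  · exact prod_nonneg fun y _ => Real.rpow_nonneg (hr j y) _
  · exact le_rfl

lemma Afun_pos {r : J → Y → ℝ} (hr : ∀ j y, 0 < r j y) {x : X} (hx : ∃ j, x ∈ S j) :
    0 < Afun p S r x := by
  obtain ⟨j, hj⟩ := hx
  have hpos : ∀ i, 0 < ∏ y, r i y ^ (p x y / margX p x) := fun i =>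
    prod_pos fun y _ => Real.rpow_pos_of_pos (hr i y) _
  refine sum_pos' (fun i _ => ?_) ⟨j, mem_univ j, ?_⟩
  · split_ifs
    · exact (hpos i).le
    · exact le_rfl
  · rw [if_pos hj]
    exact hpos j

lemma continuous_Afun (hp : ∀ x y, 0 ≤ p x y) (hpx : ∀ x, 0 < margX p x) (x : X) :
    Continuous fun r : J → Y → ℝ => Afun p S r x := by
  refine continuous_finsetSum _ fun j _ => ?_
  split_ifs
  · refine continuous_finsetProd _ fun y _ => ?_
    exact Continuous.rpow_const (by fun_prop) fun _ => Or.inr (div_nonneg (hp x y) (hpx x).le)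
  · exact continuous_const

lemma Afun_concave (hp : ∀ x y, 0 ≤ p x y) (hpx : ∀ x, 0 < margX p x) {r s : J → Y → ℝ}
    (hr : ∀ j y, 0 ≤ r j y) (hs : ∀ j y, 0 ≤ s j y) {α β : ℝ} (hα : 0 ≤ α) (hβ : 0 ≤ β) (x : X) :
    α * Afun p S r x + β * Afun p S s x ≤ Afun p S (α • r + β • s) x := by
  have hw : ∀ y, 0 ≤ p x y / margX p x := fun y => div_nonneg (hp x y) (hpx x).le
  have hw1 : ∑ y, p x y / margX p x = 1 := by
    rw [← sum_div]
    exact div_self (hpx x).ne'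
  unfold Afun
  rw [mul_sum, mul_sum, ← sum_add_distrib]
  refine sum_le_sum fun j _ => ?_
  split_ifs
  · rw [← prod_mul_rpow_of_sum_eq_one hw hw1 hα (hr j),
      ← prod_mul_rpow_of_sum_eq_one hw hw1 hβ (hs j)]
    exact prod_rpow_add_prod_rpow_le hw hw1 (fun y => mul_nonneg hα (hr j y))
      fun y => mul_nonneg hβ (hs j y)
  · simp

end Afun

lemma convex_Ka [Fintype X] [Fintype Y] [Fintype J] [DecidableEq X] {p : X → Y → ℝ}
    {S : J → Finset X} (hp : ∀ x y, 0 ≤ p x y) (hpx : ∀ x, 0 < margX p x) :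
    Convex ℝ (Ka p S) := by
  rintro a ⟨r, hr, ha⟩ b ⟨s, hs, hb⟩ α β hα hβ hαβ
  refine ⟨α • r + β • s, convex_Kr J Y hr hs hα hβ hαβ, fun x => ⟨?_, ?_⟩⟩
  · exact add_nonneg (mul_nonneg hα (ha x).1) (mul_nonneg hβ (hb x).1)
  · exact (add_le_add (mul_le_mul_of_nonneg_left (ha x).2 hα)
      (mul_le_mul_of_nonneg_left (hb x).2 hβ)).trans (Afun_concave hp hpx hr.1 hs.1 hα hβ x)

lemma isCompact_Ka [Fintype X] [Fintype Y] [Fintype J] [DecidableEq X] {p : X → Y → ℝ}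
    {S : J → Finset X} (hp : ∀ x y, 0 ≤ p x y) (hpx : ∀ x, 0 < margX p x) :
    IsCompact (Ka p S) := by
  have himage : Ka p S = (fun z : (J → Y → ℝ) × (X → ℝ) => fun x => z.2 x * Afun p S z.1 x) ''
      (Kr J Y ×ˢ Set.univ.pi fun _ : X => Set.Icc (0 : ℝ) 1) := by
    ext a
    constructor
    · rintro ⟨r, hr, ha⟩
      refine ⟨(r, fun x => a x / Afun p S r x), ⟨hr, fun x _ => ⟨?_, ?_⟩⟩, ?_⟩
      · exact div_nonneg (ha x).1 (Afun_nonneg hr.1 x)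
      · exact div_le_one_of_le₀ (ha x).2 (Afun_nonneg hr.1 x)
      · funext x
        refine div_mul_cancel_of_imp fun h => ?_
        exact le_antisymm ((ha x).2.trans_eq h) (ha x).1
    · rintro ⟨⟨r, t⟩, ⟨hr, ht⟩, rfl⟩
      refine ⟨r, hr, fun x => ⟨?_, ?_⟩⟩
      · exact mul_nonneg (ht x trivial).1 (Afun_nonneg hr.1 x)
      · exact mul_le_of_le_one_left (Afun_nonneg hr.1 x) (ht x trivial).2
  rw [himage]
  refine ((isCompact_Kr J Y).prod (isCompact_univ_pi fun _ => isCompact_Icc)).image ?_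
  exact continuous_pi fun x =>
    ((continuous_apply x).comp continuous_snd).mul ((continuous_Afun hp hpx x).comp continuous_fst)

/-- `K_a` is a convex corner: convex, compact, contained in the nonnegative
orthant, downward closed, and containing a point with all coordinates strictly positive. -/
theorem Ka_is_convex_corner (X Y J : Type*) [Fintype X] [Fintype Y] [Fintype J]
    [Nonempty X] [Nonempty Y] [DecidableEq X]
    (p : X → Y → ℝ) (S : J → Finset X)
    (hp : ∀ x y, 0 ≤ p x y) (hptot : ∑ x, ∑ y, p x y = 1)
    (hpx : ∀ x, 0 < margX p x) (hpy : ∀ y, 0 < margY p y)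
    (hcov : ∀ x, ∃ j, x ∈ S j) :
    Convex ℝ (Ka p S) ∧
    IsCompact (Ka p S) ∧
    (∀ a ∈ Ka p S, ∀ x, 0 ≤ a x) ∧
    (∀ a ∈ Ka p S, ∀ a' : X → ℝ, (∀ x, 0 ≤ a' x ∧ a' x ≤ a x) → a' ∈ Ka p S) ∧
    (∃ a ∈ Ka p S, ∀ x, 0 < a x) := by
  refine ⟨convex_Ka hp hpx, isCompact_Ka hp hpx, ?_, ?_, ?_⟩
  · rintro a ⟨r, hr, ha⟩ x
    exact (ha x).1
  · rintro a ⟨r, hr, ha⟩ a' ha'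
    exact ⟨r, hr, fun x => ⟨(ha' x).1, (ha' x).2.trans (ha x).2⟩⟩
  · obtain ⟨j, -⟩ := hcov (Classical.arbitrary X)
    have : Nonempty J := ⟨j⟩
    have hcard : (0 : ℝ) < Fintype.card J := by exact_mod_cast Fintype.card_pos
    have hpos : ∀ (_ : J) (_ : Y), 0 < (Fintype.card J : ℝ)⁻¹ := fun _ _ => inv_pos.2 hcard
    refine ⟨fun x => Afun p S (fun _ _ => (Fintype.card J : ℝ)⁻¹) x,
      ⟨fun _ _ => (Fintype.card J : ℝ)⁻¹, ⟨fun j y => (hpos j y).le, fun y => ?_⟩,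
        fun x => ⟨(Afun_pos hpos (hcov x)).le, le_rfl⟩⟩, fun x => Afun_pos hpos (hcov x)⟩
    simp [hcard.ne']
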